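/- Let p be a prime, q = p^m a power of p, n ≥ 1, and let L(X) = Σ_{i=0}^{n-1} a_i X^{q^i} with a_i ∈ F_{q^n} and (a_1, …, a_{n−1}) ≠ (0, …, 0). Assume Tr_{q^n/q}(L(x)/x) ≠ 0 for every nonzero x ∈ F_{q^n}, and assume Tr_{q^n/q}(a_0) ≠ 0. Then for every integer 1 ≤ j ≤ q^n−2 with gcd(j, q^n−1) = 1, there exists an index i with 1 ≤ i ≤ n−1 such that a_i ≠ 0 and Lead(Res(j(q^i−1))) ≥ 1 + ⌈ 2q^n / ((q−1)·⌊2q^{n/2}⌋) ⌉. -/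

import Mathlib

/-- `leadFn p N j` is the smallest nonnegative integer in the `p`-cyclotomic coset of
`j` modulo `N`, i.e. the smallest `k` with `k ≡ j·p^u (mod N)` for some `u ≥ 0`. -/
noncomputable def leadFn (p N j : ℕ) : ℕ := sInf {k : ℕ | ∃ u : ℕ, k % N = j * p ^ u % N}


lemma zmod_sum_range (n : ℕ) [NeZero n] {M : Type*} [AddCommMonoid M] (g : ZMod n → M) :
    ∑ k : ZMod n, g k = ∑ j ∈ Finset.range n, g (j : ZMod n) := by
  symm
  refine Finset.sum_nbij' (fun j => (j : ZMod n)) (fun k => k.val) ?_ ?_ ?_ ?_ ?_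
  · intros; simp
  · intro k _; simpa using ZMod.val_lt k
  · intro j hj; exact ZMod.val_cast_of_lt (by simpa using hj)
  · intro k _; simp
  · intros; rfl

lemma carry_exists (n : ℕ) [NeZero n] (q : ℤ) (d : ZMod n → ℤ)
    (hd : (q ^ n - 1) ∣ ∑ k : ZMod n, d k * q ^ k.val) :
    ∃ t : ZMod n → ℤ, ∀ k, d k = q * t k - t (k - 1) := by
  obtain ⟨w, hw⟩ := hd
  let T : ℕ → ℤ := fun r => q ^ r * w - ∑ j ∈ Finset.range r, q ^ (r - 1 - j) * d (-1 - (j : ZMod n))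
  have hT0 : T 0 = w := by simp [T]
  have hTs : ∀ r, T (r + 1) = q * T r - d (-1 - (r : ZMod n)) := by
    intro r
    simp only [T]
    rw [Finset.sum_range_succ, mul_sub, Finset.mul_sum]
    have : ∑ j ∈ Finset.range r, q ^ (r + 1 - 1 - j) * d (-1 - (j : ZMod n))
        = ∑ j ∈ Finset.range r, q * (q ^ (r - 1 - j) * d (-1 - (j : ZMod n))) := by
      refine Finset.sum_congr rfl fun j hj => ?_
      have hj' : j < r := by simpa using hj
      rw [show r + 1 - 1 - j = (r - 1 - j) + 1 by omega, pow_succ]; ring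
    rw [this]
    simp
    ring
  have hTn : T n = w := by
    simp only [T]
    have h1 : ∑ j ∈ Finset.range n, q ^ (n - 1 - j) * d (-1 - (j : ZMod n))
        = ∑ k : ZMod n, d k * q ^ k.val := by
      rw [zmod_sum_range, ← Finset.sum_range_reflect]
      refine Finset.sum_congr rfl fun j hj => ?_
      have hj' : j < n := by simpa using hj
      rw [ZMod.val_cast_of_lt hj', mul_comm]
      have : ((n - 1 - j : ℕ) : ZMod n) = -1 - (j : ZMod n) := by
        have : ((n - 1 - j + (1 + j) : ℕ) : ZMod n) = 0 := by
          rw [show n - 1 - j + (1 + j) = n by omega]; simp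
        push_cast at this
        linear_combination this
      rw [this, show n - 1 - (n - 1 - j) = j by omega, show -1 - (-1 - (j : ZMod n)) = j by ring]
    rw [h1, hw]; ring
  refine ⟨fun k => T (-1 - k).val, fun k => ?_⟩
  have hk : -1 - (k - 1) = (-1 - k) + 1 := by ring
  have hr : (((-1 - k).val : ℕ) : ZMod n) = -1 - k := by simp
  have hlt := ZMod.val_lt (-1 - k)
  have key := hTs (-1 - k).val
  rw [hr, show -1 - (-1 - k) = k by ring] at key
  have : T (-1 - (k - 1)).val = T ((-1 - k).val + 1) := by
    rw [hk]
    have e : ((((-1 - k).val + 1 : ℕ)) : ZMod n) = -1 - k + 1 := by push_cast; rw [hr]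
    rw [← e, ZMod.val_natCast]
    rcases Nat.lt_or_ge ((-1 - k).val + 1) n with h | h
    · rw [Nat.mod_eq_of_lt h]
    · have : (-1 - k).val + 1 = n := by omega
      rw [this, Nat.mod_self, hT0, hTn]
  simp only
  rw [this, key]; ring

open Finset in
set_option maxHeartbeats 2000000 in
lemma comb_core (n q h h' : ℕ) [NeZero n] (hq : 3 ≤ q) (hh : h + h' + 1 = q)
    (h1 : h ≤ h') (h2 : h' ≤ h + 1) (i s : ZMod n) (hi : i ≠ 0) (hs : s ≠ 0) (hsi : s ≠ i)
    (hsi' : s + i ≠ 0) (hii : i + i ≠ 0)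
    (f : Fin (q - 1) → ZMod n × ZMod n)
    (hJ1 : ∀ r, (f r).2 - (f r).1 ≠ -i) (hJ2 : ∀ r, (f r).2 - (f r).1 ≠ i - s)
    (c : ZMod n → ℤ)
    (hc0 : c 0 = -h) (hcs : c s = -h') (hci : c i = h) (hcsi : c (s + i) = h')
    (hcz : ∀ k, k ≠ 0 → k ≠ s → k ≠ i → k ≠ s + i → c k = 0)
    (hcsum : ∑ k, c k = 0) (ino out : ZMod n → ℕ)
    (hin : ∀ k, ino k = #{r | (f r).2 = k}) (hout : ∀ k, out k = #{r | (f r).1 = k})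
    (t : ZMod n → ℤ) (ht : ∀ k, c k - (ino k - out k) = q * t k - t (k - 1)) :
    (∀ r, f r = (0, i) ∨ f r = (s, s + i)) ∧ #{r | f r = (0, i)} = h := by
  have hcard : #(univ : Finset (Fin (q - 1))) = q - 1 := by simp
  -- pairs of distinct sources / sinks
  have hout2 : ∀ k l, k ≠ l → out k + out l ≤ q - 1 := by
    intro k l hkl
    rw [hout, hout]; refine le_trans ?_ hcard.le; rw [← card_union_of_disjoint]
    · exact card_le_card (subset_univ _)
    · rw [disjoint_filter]; rintro r - e e'; exact hkl (e.symm.trans e')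
  have hin2 : ∀ k l, k ≠ l → ino k + ino l ≤ q - 1 := by
    intro k l hkl
    rw [hin, hin]; refine le_trans ?_ hcard.le; rw [← card_union_of_disjoint]
    · exact card_le_card (subset_univ _)
    · rw [disjoint_filter]; rintro r - e e'; exact hkl (e.symm.trans e')
  have hcut : ∀ k l, l - k = -i → out k + ino l ≤ q - 1 := by
    intro k l hkl
    rw [hin, hout]; refine le_trans ?_ hcard.le; rw [← card_union_of_disjoint]
    · exact card_le_card (subset_univ _)
    · rw [disjoint_filter]; rintro r - e e'; exact hJ1 r (by rw [e, e', hkl])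
  have hout1 : ∀ k, out k ≤ q - 1 := by
    intro k; rw [hout]; refine le_trans ?_ hcard.le; exact card_le_card (subset_univ _)
  have hin1 : ∀ k, ino k ≤ q - 1 := by
    intro k; rw [hin]; refine le_trans ?_ hcard.le; exact card_le_card (subset_univ _)
  have hcle : ∀ k, c k ≤ h' ∧ -(h' : ℤ) ≤ c k := by
    intro k
    by_cases e1 : k = 0
    · rw [e1, hc0]; omega
    by_cases e2 : k = s
    · rw [e2, hcs]; omega
    by_cases e3 : k = i
    · rw [e3, hci]; omega
    by_cases e4 : k = s + i
    · rw [e4, hcsi]; omega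
    rw [hcz k e1 e2 e3 e4]; omega
  -- |t| ≤ 1
  have ht1 : ∀ k, |t k| ≤ 1 := by
    obtain ⟨k0, -, hk0⟩ := exists_max_image (univ : Finset (ZMod n)) (fun k => |t k|) ⟨0, mem_univ _⟩
    intro k
    refine (hk0 k (mem_univ _)).trans ?_
    by_contra hcon
    push Not at hcon
    have e := ht k0
    have b := hk0 (k0 - 1) (mem_univ _)
    have c1 := hcle k0
    have c2 := hout1 k0
    have c3 := hin1 k0
    have hq' : (3 : ℤ) ≤ q := by exact_mod_cast hq
    rcases abs_cases (t k0) with ⟨ea, hs0⟩ | ⟨ea, hs0⟩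
    · rw [ea] at b hcon
      have := (abs_le.mp b).2
      have : (q : ℤ) * t k0 - t (k0 - 1) ≥ (q - 1) * 2 := by nlinarith
      omega
    · rw [ea] at b hcon
      have := (abs_le.mp b).1
      have : (q : ℤ) * t k0 - t (k0 - 1) ≤ -((q - 1) * 2) := by nlinarith
      omega
  have ht1' : ∀ k, t k = -1 ∨ t k = 0 ∨ t k = 1 := by
    intro k; have := abs_le.mp (ht1 k); omega
  have n1 : (1 : ZMod n) ≠ 0 := by
    intro e; apply hi; rw [← mul_one i, e, mul_zero]
  have n2 : (1 : ZMod n) ≠ -1 := by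
    intro e; apply hii; linear_combination i * e
  have hkk : ∀ k : ZMod n, k - 1 ≠ k := by
    intro k e; apply n1; linear_combination -e
  -- positive carries occur at sinks
  have hpos : ∀ k, t k = 1 → k = i ∨ k = s + i := by
    intro k hk
    by_contra hcon
    push Not at hcon
    have hck : c k ≤ 0 := by
      by_cases e1 : k = 0
      · rw [e1, hc0]; omega
      by_cases e2 : k = s
      · rw [e2, hcs]; omega
      rw [hcz k e1 e2 hcon.1 hcon.2]
    have e := ht k
    rw [hk] at e
    have o := hout2 k (k - 1) (hkk k).symm
    have e' := ht (k - 1)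
    have b' := hcle (k - 1)
    rcases ht1' (k - 1) with u | u | u <;> rw [u] at e e' <;>
      rcases ht1' (k - 1 - 1) with v | v | v <;> rw [v] at e' <;> omega
  have hneg : ∀ k, t k = -1 → k = 0 ∨ k = s := by
    intro k hk
    by_contra hcon
    push Not at hcon
    have hck : 0 ≤ c k := by
      by_cases e1 : k = i
      · rw [e1, hci]; omega
      by_cases e2 : k = s + i
      · rw [e2, hcsi]; omega
      rw [hcz k hcon.1 hcon.2 e1 e2]
    have e := ht k
    rw [hk] at e
    have o := hin2 k (k - 1) (hkk k).symm
    have e' := ht (k - 1)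
    have b' := hcle (k - 1)
    rcases ht1' (k - 1) with u | u | u <;> rw [u] at e e' <;>
      rcases ht1' (k - 1 - 1) with v | v | v <;> rw [v] at e' <;> omega
  have hinsum : ∑ k, ino k = q - 1 := by
    rw [← hcard, card_eq_sum_card_fiberwise (f := fun r => (f r).2) (t := univ) (by simp)]
    exact sum_congr rfl fun k _ => hin k
  have houtsum : ∑ k, out k = q - 1 := by
    rw [← hcard, card_eq_sum_card_fiberwise (f := fun r => (f r).1) (t := univ) (by simp)]
    exact sum_congr rfl fun k _ => hout k
  have htsum : ∑ k, t k = 0 := by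
    have e : ∑ k, (c k - ((ino k : ℤ) - out k)) = ∑ k, (q * t k - t (k - 1)) :=
      sum_congr rfl fun k _ => ht k
    rw [sum_sub_distrib, sum_sub_distrib, sum_sub_distrib, hcsum, ← mul_sum,
      ← Nat.cast_sum, ← Nat.cast_sum, hinsum, houtsum] at e
    have e2 : ∑ k, t (k - 1) = ∑ k, t k := Equiv.sum_comp (Equiv.subRight (1 : ZMod n)) t
    rw [e2] at e
    have hq' : (3 : ℤ) ≤ q := by exact_mod_cast hq
    have : ((q : ℤ) - 1) * ∑ k, t k = 0 := by linarith
    rcases mul_eq_zero.mp this with h | h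
    · omega
    · exact h
  have hssi : s ≠ s + i := by intro e; apply hi; linear_combination -e
  have hisi : i ≠ s + i := by intro e; apply hs; linear_combination -e
  have htz : ∀ k, k ≠ 0 → k ≠ s → k ≠ i → k ≠ s + i → t k = 0 := by
    intro k a b c' d
    rcases ht1' k with u | u | u
    · rcases hneg k u with e | e
      · exact absurd e a
      · exact absurd e b
    · exact u
    · rcases hpos k u with e | e
      · exact absurd e c'
      · exact absurd e d
  have ht4 : t 0 + t s + t i + t (s + i) = 0 := by
    rw [← htsum]
    have : ∑ k, t k = ∑ k ∈ ({0, s, i, s + i} : Finset (ZMod n)), t k := by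
      symm
      apply sum_subset (subset_univ _)
      intro k _ hk
      simp only [mem_insert, mem_singleton, not_or] at hk
      exact htz k hk.1 hk.2.1 hk.2.2.1 hk.2.2.2
    rw [this, sum_insert, sum_insert, sum_insert, sum_singleton]
    · ring
    · simp [hisi]
    · simp [hsi, hssi]
    · simp [hs.symm, hi.symm, hsi'.symm]
  have np0 : t 0 ≠ 1 := fun e => by
    rcases hpos 0 e with e | e
    · exact hi e.symm
    · exact hsi' e.symm
  have nps : t s ≠ 1 := fun e => by
    rcases hpos s e with e | e
    · exact hsi e
    · exact hssi e
  have nni : t i ≠ -1 := fun e => by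
    rcases hneg i e with e | e
    · exact hi e
    · exact hsi e.symm
  have nnsi : t (s + i) ≠ -1 := fun e => by
    rcases hneg _ e with e | e
    · exact hsi' e
    · exact hssi e.symm
  have E0 := ht 0
  have Es := ht s
  have Ei := ht i
  have Esi := ht (s + i)
  rw [hc0] at E0
  rw [hcs] at Es
  rw [hci] at Ei
  rw [hcsi] at Esi
  have C1 := hcut i 0 (by ring)
  have C2 := hcut (s + i) s (by ring)
  have O0s := hout2 0 s hs.symm
  have O0i := hout2 0 i hi.symm
  have Ossi := hout2 s (s + i) hssi
  have Oisi := hout2 i (s + i) hisi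
  have I0i := hin2 0 i hi.symm
  have Issi := hin2 s (s + i) hssi
  have Iisi := hin2 i (s + i) hisi
  have B0 := abs_le.mp (ht1 (0 - 1))
  have Bs := abs_le.mp (ht1 (s - 1))
  have Bi := abs_le.mp (ht1 (i - 1))
  have Bsi := abs_le.mp (ht1 (s + i - 1))
  have b0 := abs_le.mp (ht1 0)
  have bs := abs_le.mp (ht1 s)
  have bi := abs_le.mp (ht1 i)
  have bsi := abs_le.mp (ht1 (s + i))
  have t0 : ∀ k, t k = 0 := by
    by_cases z : t i = 0 ∧ t (s + i) = 0
    · obtain ⟨z1, z2⟩ := z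
      have z3 : t 0 = 0 := by omega
      have z4 : t s = 0 := by omega
      intro k
      by_cases a1 : k = 0
      · rw [a1, z3]
      by_cases a2 : k = s
      · rw [a2, z4]
      by_cases a3 : k = i
      · rw [a3, z1]
      by_cases a4 : k = s + i
      · rw [a4, z2]
      exact htz k a1 a2 a3 a4
    exfalso
    by_cases p1 : t i = 1
    · rw [p1] at Ei
      by_cases p2 : t (s + i) = 1
      · rw [p2] at Esi
        have x1 : t (i - 1) = 1 := by omega
        have x2 : t (s + i - 1) = 1 := by omega
        have y1 : i - 1 = s + i := (hpos _ x1).resolve_left (hkk i)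
        have y2 : s + i - 1 = i := (hpos _ x2).resolve_right (hkk _)
        apply n2
        linear_combination -y1 - y2
      have p2' : t (s + i) = 0 := by omega
      have pi1 : t (i - 1) ≠ 1 := fun x => by
        rcases hpos _ x with y | y
        · exact hkk i y
        · rw [y] at x; exact p2 x
      by_cases m : t 0 = -1
      · rw [m] at E0
        have m2 : t s = 0 := by omega
        have pm1 : t (0 - 1) ≠ -1 := fun x => by
          rcases hneg _ x with y | y
          · exact hkk 0 y
          · rw [y] at x; omega
        omega
      · have m0 : t 0 = 0 := by omega
        have ms : t s = -1 := by omega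
        rw [m0] at E0
        rw [p2'] at Esi
        rw [ms] at Es
        have pm1 : t (s - 1) ≠ -1 := fun x => by
          rcases hneg _ x with y | y
          · rw [y] at x; exact m x
          · exact hkk s y
        have x1 : t (0 - 1) = 1 := by omega
        have x2 : t (s + i - 1) = -1 := by omega
        have y1 : 0 - 1 = i := by
          rcases hpos _ x1 with y | y
          · exact y
          · rw [y] at x1; omega
        have y2 : s + i - 1 = s := by
          rcases hneg _ x2 with y | y
          · rw [y] at x2; omega
          · exact y
        apply n2
        linear_combination -y1 - y2
    · have p1' : t i = 0 := by omega
      have p2 : t (s + i) = 1 := by omega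
      rw [p1'] at Ei
      rw [p2] at Esi
      have pi1 : t (s + i - 1) ≠ 1 := fun x => by
        rcases hpos _ x with y | y
        · rw [y] at x; exact p1 x
        · exact hkk _ y
      by_cases m : t s = -1
      · rw [m] at Es
        have m2 : t 0 = 0 := by omega
        have pm1 : t (s - 1) ≠ -1 := fun x => by
          rcases hneg _ x with y | y
          · rw [y] at x; omega
          · exact hkk s y
        omega
      · have m0 : t s = 0 := by omega
        have ms : t 0 = -1 := by omega
        rw [m0] at Es
        rw [ms] at E0
        have pm1 : t (0 - 1) ≠ -1 := fun x => by
          rcases hneg _ x with y | y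
          · exact hkk 0 y
          · rw [y] at x; exact m x
        have x1 : t (s - 1) = 1 := by omega
        have x2 : t (i - 1) = -1 := by omega
        have y1 : s - 1 = s + i := by
          rcases hpos _ x1 with y | y
          · rw [y] at x1; omega
          · exact y
        have y2 : i - 1 = 0 := by
          rcases hneg _ x2 with y | y
          · exact y
          · rw [y] at x2; omega
        apply n2
        linear_combination -y1 - y2
  rw [t0, t0] at E0 Es Ei Esi
  have hqq : h + h' = q - 1 := by omega
  have o0 : out 0 = h := by omega
  have os : out s = h' := by omega
  have ii' : ino i = h := by omega
  have isi : ino (s + i) = h' := by omega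
  have hsrc : ∀ r, (f r).1 = 0 ∨ (f r).1 = s := by
    have : (univ.filter fun r => (f r).1 = 0) ∪ (univ.filter fun r => (f r).1 = s) = univ := by
      apply eq_univ_of_card
      rw [card_union_of_disjoint, ← hout, ← hout]
      · simp; omega
      · rw [disjoint_filter]; rintro r - e e'; exact hs (e'.symm.trans e)
    intro r
    have := this ▸ mem_univ r
    simpa using this
  have hsnk : ∀ r, (f r).2 = i ∨ (f r).2 = s + i := by
    have : (univ.filter fun r => (f r).2 = i) ∪ (univ.filter fun r => (f r).2 = s + i) = univ := by
      apply eq_univ_of_card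
      rw [card_union_of_disjoint, ← hin, ← hin]
      · simp; omega
      · rw [disjoint_filter]; rintro r - e e'; exact hisi (e.symm.trans e')
    intro r
    have := this ▸ mem_univ r
    simpa using this
  have hssub : (univ.filter fun r => (f r).1 = s) ⊆ (univ.filter fun r => (f r).2 = s + i) := by
    intro r hr
    simp only [mem_filter, mem_univ, true_and] at hr ⊢
    refine (hsnk r).resolve_left fun e => hJ2 r (by rw [e, hr])
  have hseq := eq_of_subset_of_card_le hssub (by rw [← hin, ← hout]; omega)
  have hiff : ∀ r, (f r).1 = s ↔ (f r).2 = s + i := by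
    intro r
    have := congrArg (r ∈ ·) hseq
    simpa using this
  have hall : ∀ r, f r = (0, i) ∨ f r = (s, s + i) := by
    intro r
    by_cases e : (f r).1 = s
    · right; exact Prod.ext e ((hiff r).mp e)
    · left
      refine Prod.ext ((hsrc r).resolve_right e) ((hsnk r).resolve_right fun e' => e ((hiff r).mpr e'))
  refine ⟨hall, ?_⟩
  rw [← o0, hout]
  congr 1
  ext r
  simp only [mem_filter, mem_univ, true_and]
  constructor
  · intro e; rw [e]
  · intro e
    refine (hall r).resolve_right fun e' => ?_
    rw [e'] at e; exact hs e

open Finset in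
lemma comb_main (n q h h' : ℕ) [NeZero n] (hq : 3 ≤ q) (hh : h + h' + 1 = q)
    (h1 : h ≤ h') (h2 : h' ≤ h + 1) (i s : ZMod n) (hi : i ≠ 0) (hs : s ≠ 0) (hsi : s ≠ i)
    (hsi' : s + i ≠ 0) (hii : i + i ≠ 0)
    (f : Fin (q - 1) → ZMod n × ZMod n)
    (hJ1 : ∀ r, (f r).2 - (f r).1 ≠ -i) (hJ2 : ∀ r, (f r).2 - (f r).1 ≠ i - s)
    (hdiv : ((q : ℤ) ^ n - 1) ∣ (∑ r, ((q : ℤ) ^ (f r).2.val - (q : ℤ) ^ (f r).1.val)) -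
      (h * ((q : ℤ) ^ i.val - 1) + h' * ((q : ℤ) ^ (s + i).val - (q : ℤ) ^ s.val))) :
    (∀ r, f r = (0, i) ∨ f r = (s, s + i)) ∧ #{r | f r = (0, i)} = h := by
  have hssi : s ≠ s + i := by intro e; apply hi; linear_combination -e
  have hisi : i ≠ s + i := by intro e; apply hs; linear_combination -e
  let c : ZMod n → ℤ := fun k => (if k = i then (h : ℤ) else 0) - (if k = 0 then (h : ℤ) else 0)
    + (if k = s + i then (h' : ℤ) else 0) - (if k = s then (h' : ℤ) else 0)
  let ino : ZMod n → ℕ := fun k => #{r | (f r).2 = k}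
  let out : ZMod n → ℕ := fun k => #{r | (f r).1 = k}
  have key : ∀ g : Fin (q - 1) → ZMod n, ∑ r, (q : ℤ) ^ (g r).val
      = ∑ k, ((#{r | g r = k} : ℕ) : ℤ) * (q : ℤ) ^ k.val := by
    intro g
    rw [← sum_fiberwise univ g]
    refine sum_congr rfl fun k _ => ?_
    rw [← nsmul_eq_mul, ← sum_const]
    refine sum_congr rfl fun r hr => ?_
    simp only [mem_filter, mem_univ, true_and] at hr
    rw [hr]
  obtain ⟨t, ht⟩ := carry_exists n q (fun k => c k - ((ino k : ℤ) - out k)) (by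
    have e : ∑ k : ZMod n, (c k - ((ino k : ℤ) - out k)) * (q : ℤ) ^ k.val =
      -((∑ r, ((q : ℤ) ^ (f r).2.val - (q : ℤ) ^ (f r).1.val)) -
      (h * ((q : ℤ) ^ i.val - 1) + h' * ((q : ℤ) ^ (s + i).val - (q : ℤ) ^ s.val))) := by
      rw [sum_sub_distrib, key, key]
      simp only [sub_mul, sum_sub_distrib, ino, out, c, add_mul, sum_add_distrib, ite_mul, zero_mul,
        sum_ite_eq', mem_univ, if_true]
      simp
      ring
    rw [e]
    exact hdiv.neg_right)
  refine comb_core n q h h' hq hh h1 h2 i s hi hs hsi hsi' hii f hJ1 hJ2 c ?_ ?_ ?_ ?_ ?_ ?_ ino out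
    (fun _ => rfl) (fun _ => rfl) t ht
  · simp [c, hi.symm, hs.symm, hsi'.symm]
  · simp [c, hs, hsi, hi]
  · simp [c, hi, hisi, hsi.symm]
  · simp [c, hi, hs, hsi']
  · intro k a1 a2 a3 a4; simp [c, a1, a2, a3, a4]
  · simp [c, sum_sub_distrib, sum_add_distrib]

open Finset in
lemma sum_units_zpow (E : Type*) [Field E] [Fintype E] [DecidableEq E] (z : ℤ) :
    ∑ u : Eˣ, ((u : E) ^ z) = if ((Fintype.card E : ℤ) - 1) ∣ z then -1 else 0 := by
  have hc : 1 < Fintype.card E := Fintype.one_lt_card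
  have hN : ((Fintype.card E - 1 : ℕ) : ℤ) = (Fintype.card E : ℤ) - 1 := by
    push_cast [Nat.cast_sub hc.le]; ring
  set N := Fintype.card E - 1 with hNdef
  have hpos : 0 < N := by omega
  have hz : 0 ≤ z % (N : ℤ) := Int.emod_nonneg _ (by omega)
  obtain ⟨r, hr⟩ := Int.eq_ofNat_of_zero_le hz
  have e : ∀ u : Eˣ, ((u : E) ^ z) = ((u ^ r : Eˣ) : E) := by
    intro u
    have h1 : u ^ N = 1 := by
      have := FiniteField.pow_card_sub_one_eq_one (u : E) u.ne_zero
      exact Units.ext (by simpa using this)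
    have h2 : u ^ z = u ^ r := by
      rw [← Int.emod_add_mul_ediv z N, hr, zpow_add, zpow_mul, zpow_natCast, zpow_natCast, h1]
      simp
    rw [← h2]; simp
  rw [sum_congr rfl fun u _ => e u]
  have := FiniteField.sum_pow_units E r
  simp only [Units.val_pow_eq_pow_val] at this ⊢
  rw [this, ← hN]
  have hiff : (N ∣ r) ↔ ((N : ℤ) ∣ z) := by
    rw [← Int.natCast_dvd_natCast, Int.dvd_iff_emod_eq_zero (b := z), hr]
    constructor
    · intro h
      have := Int.emod_lt_of_pos z (by omega : (0 : ℤ) < N)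
      rw [hr] at this
      have := Int.eq_zero_of_dvd_of_nonneg_of_lt (by omega) this h
      omega
    · intro h; rw [h]; simp
  by_cases hd : N ∣ r
  · rw [if_pos hd, if_pos (hiff.mp hd)]
  · rw [if_neg hd, if_neg fun h => hd (hiff.mpr h)]

open Finset in
/-- If a power of a Laurent polynomial is constantly `1` on the nonzero elements, then all its
non-constant coefficients, reduced modulo `|E| - 1`, vanish. -/
lemma coeff_zero (E : Type*) [Field E] [Fintype E] (A : Type*) [Fintype A] [DecidableEq A]
    (B : A → E) (e : A → ℤ) (N : ℕ)
    (hP : ∀ x : E, x ≠ 0 → (∑ v, B v * x ^ e v) ^ N = 1) (D : ℤ)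
    (hD : ¬ ((Fintype.card E : ℤ) - 1) ∣ D) :
    ∑ f : Fin N → A with ((Fintype.card E : ℤ) - 1) ∣ (∑ r, e (f r)) - D, ∏ r, B (f r) = 0 := by
  classical
  have h1 : ∑ u : Eˣ, (u : E) ^ (-D) * (∑ v, B v * (u : E) ^ e v) ^ N = 0 := by
    rw [sum_congr rfl fun u _ => by rw [hP u u.ne_zero, mul_one], sum_units_zpow, if_neg]
    rwa [dvd_neg]
  have h2 : ∀ u : Eˣ, (u : E) ^ (-D) * (∑ v, B v * (u : E) ^ e v) ^ N
      = ∑ f : Fin N → A, (∏ r, B (f r)) * (u : E) ^ ((∑ r, e (f r)) - D) := by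
    intro u
    have : (∑ v, B v * (u : E) ^ e v) ^ N = ∏ _r : Fin N, ∑ v, B v * (u : E) ^ e v := by simp
    rw [this, Fintype.prod_sum, mul_sum]
    refine sum_congr rfl fun f _ => ?_
    rw [prod_mul_distrib, sub_eq_add_neg, zpow_add₀ u.ne_zero]
    have : ∏ r, (u : E) ^ e (f r) = (u : E) ^ (∑ r, e (f r)) := by
      induction (univ : Finset (Fin N)) using Finset.induction_on with
      | empty => simp
      | insert a s ha ih => rw [prod_insert ha, sum_insert ha, zpow_add₀ u.ne_zero, ih]
    rw [this]; ring
  rw [sum_congr rfl fun u _ => h2 u, sum_comm] at h1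
  simp only [← mul_sum, sum_units_zpow] at h1
  simp only [mul_ite, mul_zero, mul_neg, mul_one, ← sum_filter, sum_neg_distrib, neg_eq_zero] at h1
  exact h1

lemma choose_pred_ne_zero (E : Type*) [Field E] (p m : ℕ) [CharP E p] (hp : p.Prime)
    (h : ℕ) (hh : h ≤ p ^ m - 1) : ((Nat.choose (p ^ m - 1) h : ℕ) : E) ≠ 0 := by
  have hpos : 0 < p ^ m := pow_pos hp.pos m
  have : ∀ h, h ≤ p ^ m - 1 → ((Nat.choose (p ^ m - 1) h : ℕ) : E) = (-1) ^ h := by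
    intro h
    induction h with
    | zero => simp
    | succ k ih =>
      intro hk
      have e := Nat.choose_succ_succ (p ^ m - 1) k
      rw [show (p ^ m - 1).succ = p ^ m by omega] at e
      have d : p ∣ Nat.choose (p ^ m) (k + 1) :=
        hp.dvd_choose_pow (by omega) (by omega)
      have d' : ((Nat.choose (p ^ m) (k + 1) : ℕ) : E) = 0 := (CharP.cast_eq_zero_iff E p _).mpr d
      have e' := congrArg (fun z : ℕ => (z : E)) e
      simp only [Nat.succ_eq_add_one] at e'
      rw [d'] at e'
      push_cast at e'
      rw [ih (by omega)] at e'
      rw [pow_succ]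
      linear_combination -e'
  rw [this h hh]
  exact pow_ne_zero _ (by simp)

/-- The trace-like sum rewritten over arcs. -/
lemma trace_arcs (p m q n : ℕ) [NeZero n] (hp : p.Prime) (hq : q = p ^ m)
    (E : Type*) [Field E] [Fintype E] [CharP E p] (hE : Fintype.card E = q ^ n)
    (a : ℕ → E) (x : E) (hx : x ≠ 0) :
    ∑ j ∈ Finset.range n, ((∑ i ∈ Finset.range n, a i * x ^ q ^ i) / x) ^ q ^ j =
      ∑ v : ZMod n × ZMod n, (a (v.2 - v.1).val) ^ q ^ v.1.val *
        x ^ ((q : ℤ) ^ v.2.val - (q : ℤ) ^ v.1.val) := by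
  have : Fact p.Prime := ⟨hp⟩
  have hxn : ∀ y : E, y ^ q ^ n = y := fun y => by rw [← hE]; exact FiniteField.pow_card y
  have hxm : ∀ y : E, ∀ k, y ^ q ^ k = y ^ q ^ (k % n) := by
    intro y k
    have : ∀ c, y ^ q ^ (k % n + n * c) = y ^ q ^ (k % n) := by
      intro c
      induction c with
      | zero => simp
      | succ c ih => rw [show k % n + n * (c + 1) = (k % n + n * c) + n by ring, pow_add, pow_mul, hxn, ih]
    conv_lhs => rw [← Nat.mod_add_div k n]
    exact this _
  rw [Fintype.sum_prod_type, zmod_sum_range]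
  refine Finset.sum_congr rfl fun k hk => ?_
  have hk' : k < n := by simpa using hk
  rw [Finset.sum_div, hq, ← pow_mul p m k, sum_pow_char_pow, pow_mul, ← hq]
  simp only [ZMod.val_cast_of_lt hk']
  rw [← Equiv.sum_comp (Equiv.addRight (k : ZMod n)), zmod_sum_range]
  refine Finset.sum_congr rfl fun i hi => ?_
  have hi' : i < n := by simpa using hi
  simp only [Equiv.coe_addRight, add_sub_cancel_right, ZMod.val_cast_of_lt hi']
  rw [zpow_sub₀ hx, div_pow, mul_pow, mul_div_assoc]
  congr 1
  have e1 : (x ^ ((q : ℤ) ^ ((i : ZMod n) + (k : ZMod n)).val)) = x ^ q ^ ((i + k) % n) := by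
    rw [← Nat.cast_add, ZMod.val_natCast]
    exact_mod_cast zpow_natCast x _
  have e2 : (x ^ ((q : ℤ) ^ k)) = x ^ q ^ k := by
    exact_mod_cast zpow_natCast x _
  rw [e1, e2, ← hxm, ← pow_mul, ← pow_add]

lemma trace_pow (p m q n : ℕ) (hp : p.Prime) (hq : q = p ^ m)
    (E : Type*) [Field E] [Fintype E] [CharP E p] (hE : Fintype.card E = q ^ n)
    (y : E) (hy : ∑ j ∈ Finset.range n, y ^ q ^ j ≠ 0) :
    (∑ j ∈ Finset.range n, y ^ q ^ j) ^ (q - 1) = 1 := by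
  have : Fact p.Prime := ⟨hp⟩
  have hq0 : 0 < q := by rw [hq]; exact pow_pos hp.pos m
  have h1 : (∑ j ∈ Finset.range n, y ^ q ^ j) ^ q = ∑ j ∈ Finset.range n, y ^ q ^ j := by
    conv_lhs => rw [hq]
    rw [sum_pow_char_pow, ← hq]
    have e := Finset.sum_range_succ (fun j => y ^ q ^ j) n
    rw [Finset.sum_range_succ', ← hE, FiniteField.pow_card] at e
    simp only [pow_zero, pow_one, add_left_inj] at e
    rw [← e]
    refine Finset.sum_congr rfl fun j _ => ?_
    rw [← pow_mul, pow_succ]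
  have h2 : (∑ j ∈ Finset.range n, y ^ q ^ j) ^ (q - 1) * (∑ j ∈ Finset.range n, y ^ q ^ j)
     = 1 * ∑ j ∈ Finset.range n, y ^ q ^ j := by
    rw [← pow_succ, Nat.sub_add_cancel hq0, h1, one_mul]
  exact mul_right_cancel₀ hy h2


open Finset in
set_option maxHeartbeats 1000000 in
lemma padic_main (p m q n : ℕ) [NeZero n] (hp : p.Prime) (hq : q = p ^ m) (hq3 : 3 ≤ q)
    (E : Type*) [Field E] [Fintype E] [CharP E p] (hE : Fintype.card E = q ^ n)
    (a : ℕ → E)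
    (h : ∀ x : E, x ≠ 0 →
      ∑ j ∈ Finset.range n, ((∑ i ∈ Finset.range n, a i * x ^ q ^ i) / x) ^ q ^ j ≠ 0)
    (i s : ZMod n) (hi : i ≠ 0) (hs : s ≠ 0) (hsi : s ≠ i) (hsi' : s + i ≠ 0)
    (hai : a i.val ≠ 0) (han : a (-i).val = 0) (has : a (i - s).val = 0) : False := by
  classical
  have hii : i + i ≠ 0 := by
    intro e
    have : -i = i := by linear_combination -e
    rw [this] at han; exact hai han
  have hssi : s ≠ s + i := by intro e; apply hi; linear_combination -e
  have hisi : i ≠ s + i := by intro e; apply hs; linear_combination -e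
  obtain ⟨u, u', huu, hu1, hu2⟩ : ∃ u u' : ℕ, u + u' + 1 = q ∧ u ≤ u' ∧ u' ≤ u + 1 :=
    ⟨(q - 1) / 2, (q - 1) - (q - 1) / 2, by omega, by omega, by omega⟩
  set B : ZMod n × ZMod n → E := fun v => (a (v.2 - v.1).val) ^ q ^ v.1.val with hB
  set e : ZMod n × ZMod n → ℤ := fun v => (q : ℤ) ^ v.2.val - (q : ℤ) ^ v.1.val with he
  have hcardZ : (Fintype.card E : ℤ) - 1 = (q : ℤ) ^ n - 1 := by rw [hE]; push_cast; ring
  have hP : ∀ x : E, x ≠ 0 → (∑ v, B v * x ^ e v) ^ (q - 1) = 1 := by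
    intro x hx
    have := trace_arcs p m q n hp hq E hE a x hx
    simp only [hB, he]
    rw [← this]
    exact trace_pow p m q n hp hq E hE _ (h x hx)
  set D : ℤ := u * ((q : ℤ) ^ i.val - 1) + u' * ((q : ℤ) ^ (s + i).val - (q : ℤ) ^ s.val) with hDdef
  have hBz : ∀ v : ZMod n × ZMod n, (v.2 - v.1 = -i ∨ v.2 - v.1 = i - s) → B v = 0 := by
    intro v hv
    have hq0 : ∀ k, q ^ k ≠ 0 := fun k => pow_ne_zero _ (by omega)
    rcases hv with hv | hv
    · simp only [hB, hv, han]; exact zero_pow (hq0 _)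
    · simp only [hB, hv, has]; exact zero_pow (hq0 _)
  -- characterization of tuples with nonzero product
  have hchar : ∀ f : Fin (q - 1) → ZMod n × ZMod n,
      ((Fintype.card E : ℤ) - 1) ∣ (∑ r, e (f r)) - D → ∏ r, B (f r) ≠ 0 →
      (∀ r, f r = (0, i) ∨ f r = (s, s + i)) ∧ #{r | f r = (0, i)} = u := by
    intro f hf hne
    rw [hcardZ] at hf
    have hne' : ∀ r, B (f r) ≠ 0 := fun r h0 => hne (prod_eq_zero (mem_univ r) h0)
    exact comb_main n q u u' hq3 huu hu1 hu2 i s hi hs hsi hsi' hii f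
      (fun r hr => hne' r (hBz _ (Or.inl hr))) (fun r hr => hne' r (hBz _ (Or.inr hr))) hf
  have hD : ¬ ((Fintype.card E : ℤ) - 1) ∣ D := by
    intro hd
    rw [hcardZ] at hd
    have := comb_main n q u u' hq3 huu hu1 hu2 i s hi hs hsi hsi' hii (fun _ => (0, 0))
      (fun r => by simpa using hi)
      (fun r => by simpa using fun e => hsi (by linear_combination e)) (by
        simp only [sub_self, sum_const_zero, zero_sub]
        exact hd.neg_right)
    have h0 := this.1 ⟨0, by omega⟩
    rcases h0 with h0 | h0
    · exact hi (Prod.mk.inj h0).2.symm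
    · exact hs (Prod.mk.inj h0).1.symm
  have hzero := coeff_zero E (ZMod n × ZMod n) B e (q - 1) hP D hD
  -- the tuples indexed by subsets
  let F : Finset (Fin (q - 1)) → (Fin (q - 1) → ZMod n × ZMod n) :=
    fun S r => if r ∈ S then (0, i) else (s, s + i)
  have hne0 : ((0 : ZMod n), i) ≠ (s, s + i) := fun e => hs (Prod.mk.inj e).1.symm
  have hsum : ∑ f : Fin (q - 1) → ZMod n × ZMod n with
      ((Fintype.card E : ℤ) - 1) ∣ (∑ r, e (f r)) - D, ∏ r, B (f r)
      = ∑ S ∈ powersetCard u (univ : Finset (Fin (q - 1))), ∏ r, B (F S r) := by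
    have hinj : Set.InjOn F (powersetCard u (univ : Finset (Fin (q - 1)))) := by
      intro S _ S' _ hSS
      ext r
      have := congrFun hSS r
      simp only [F] at this
      by_cases h1 : r ∈ S
      · by_cases h2 : r ∈ S'
        · exact ⟨fun _ => h2, fun _ => h1⟩
        · rw [if_pos h1, if_neg h2] at this; exact absurd this hne0
      · by_cases h2 : r ∈ S'
        · rw [if_neg h1, if_pos h2] at this; exact absurd this.symm hne0
        · exact ⟨fun h3 => absurd h3 h1, fun h3 => absurd h3 h2⟩
    rw [← sum_image (f := fun f => ∏ r, B (f r)) hinj]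
    symm
    apply sum_subset
    · intro f hf
      rw [mem_image] at hf
      obtain ⟨S, hS, rfl⟩ := hf
      rw [mem_powersetCard] at hS
      simp only [mem_filter, mem_univ, true_and]
      have : ∑ r, e (F S r) = D := by
        have : ∀ r, e (F S r) = if r ∈ S then e (0, i) else e (s, s + i) := by
          intro r; simp only [F]; split_ifs <;> rfl
        rw [sum_congr rfl fun r _ => this r, sum_ite, sum_const, sum_const]
        have c1 : #({r | r ∈ S} : Finset (Fin (q - 1))) = u := by simp [hS.2]
        have c2 : #({r | r ∉ S} : Finset (Fin (q - 1))) = u' := by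
          have : (univ.filter fun r => r ∉ S) = Sᶜ := by ext; simp
          rw [this, card_compl, hS.2]; simp; omega
        rw [c1, c2]
        simp [he, hDdef]
      rw [this]; simp
    · intro f hf hf'
      by_contra hne
      simp only [mem_filter, mem_univ, true_and] at hf
      obtain ⟨h1, h2⟩ := hchar f hf hne
      apply hf'
      rw [mem_image]
      refine ⟨univ.filter fun r => f r = (0, i), ?_, ?_⟩
      · rw [mem_powersetCard]; exact ⟨subset_univ _, h2⟩
      · funext r
        simp only [F, mem_filter, mem_univ, true_and]
        split_ifs with h3
        · exact h3.symm
        · exact ((h1 r).resolve_left h3).symm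
  have hprod : ∀ S ∈ powersetCard u (univ : Finset (Fin (q - 1))),
      ∏ r, B (F S r) = B (0, i) ^ u * B (s, s + i) ^ u' := by
    intro S hS
    rw [mem_powersetCard] at hS
    have : ∀ r, B (F S r) = if r ∈ S then B (0, i) else B (s, s + i) := by
      intro r; simp only [F]; split_ifs <;> rfl
    rw [prod_congr rfl fun r _ => this r, prod_ite, prod_const, prod_const]
    have c1 : #({r | r ∈ S} : Finset (Fin (q - 1))) = u := by simp [hS.2]
    have c2 : #({r | r ∉ S} : Finset (Fin (q - 1))) = u' := by
      have : (univ.filter fun r => r ∉ S) = Sᶜ := by ext; simp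
      rw [this, card_compl, hS.2]; simp; omega
    rw [c1, c2]
  rw [hsum, sum_congr rfl hprod, sum_const, card_powersetCard, card_univ, Fintype.card_fin,
    nsmul_eq_mul] at hzero
  have hch : ((Nat.choose (q - 1) u : ℕ) : E) ≠ 0 := by
    rw [hq]; exact choose_pred_ne_zero E p m hp u (by rw [← hq]; omega)
  have hb1 : B (0, i) ≠ 0 := by simp only [hB]; apply pow_ne_zero; simpa using hai
  have hb2 : B (s, s + i) ≠ 0 := by simp only [hB]; apply pow_ne_zero; simpa using hai
  exact mul_ne_zero hch (mul_ne_zero (pow_ne_zero _ hb1) (pow_ne_zero _ hb2)) hzero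

open Finset in
/-- the case `q = 2` -/
lemma case_two (n : ℕ) [NeZero n]
    (E : Type*) [Field E] [Fintype E] [CharP E 2] (hE : Fintype.card E = 2 ^ n)
    (a : ℕ → E)
    (h : ∀ x : E, x ≠ 0 →
      ∑ j ∈ Finset.range n, ((∑ i ∈ Finset.range n, a i * x ^ 2 ^ i) / x) ^ 2 ^ j ≠ 0)
    (i : ℕ) (hi : 1 ≤ i) (hin : i < n) (hai : a i ≠ 0) : False := by
  classical
  set B : ZMod n × ZMod n → E := fun v => (a (v.2 - v.1).val) ^ 2 ^ v.1.val with hB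
  set e : ZMod n × ZMod n → ℤ := fun v => (2 : ℤ) ^ v.2.val - (2 : ℤ) ^ v.1.val with he
  have hcardZ : (Fintype.card E : ℤ) - 1 = (2 : ℤ) ^ n - 1 := by rw [hE]; push_cast; ring
  have hP : ∀ x : E, x ≠ 0 → (∑ v, B v * x ^ e v) ^ 1 = 1 := by
    intro x hx
    have := trace_arcs 2 1 2 n Nat.prime_two (by norm_num) E hE a x hx
    simp only [hB, he]
    push_cast at this
    rw [← this]
    exact trace_pow 2 1 2 n Nat.prime_two (by norm_num) E hE _ (h x hx)
  have hpw : ∀ k, k < n → (1 : ℤ) ≤ 2 ^ k ∧ (2 : ℤ) * 2 ^ k ≤ 2 ^ n := by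
    intro k hk
    refine ⟨one_le_pow₀ (by norm_num), ?_⟩
    rw [← pow_succ']; exact pow_le_pow_right₀ (by norm_num) hk
  have hi2 : (2 : ℤ) ≤ 2 ^ i := by
    calc (2 : ℤ) = 2 ^ 1 := by norm_num
      _ ≤ 2 ^ i := pow_le_pow_right₀ (by norm_num) hi
  have hD : ¬ ((Fintype.card E : ℤ) - 1) ∣ ((2 : ℤ) ^ i - 1) := by
    rw [hcardZ]
    intro hd
    have := Int.le_of_dvd (by omega) hd
    have := hpw i hin
    omega
  have hz := coeff_zero E _ B e 1 hP ((2 : ℤ) ^ i - 1) hD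
  have hset : (univ.filter fun f : Fin 1 → ZMod n × ZMod n =>
      ((Fintype.card E : ℤ) - 1) ∣ (∑ r, e (f r)) - ((2 : ℤ) ^ i - 1)) = {fun _ => (0, (i : ZMod n))} := by
    ext f
    simp only [mem_filter, mem_univ, true_and, mem_singleton, Fin.sum_univ_one, Fin.isValue]
    constructor
    · intro hd
      rw [hcardZ] at hd
      rcases hf : f 0 with ⟨k, l⟩
      rw [hf] at hd
      simp only [he] at hd
      have hk := hpw k.val (ZMod.val_lt k)
      have hl := hpw l.val (ZMod.val_lt l)
      have hi' := hpw i hin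
      have h0 : (2 : ℤ) ^ l.val - 2 ^ k.val - (2 ^ i - 1) = 0 := by
        apply Int.eq_zero_of_abs_lt_dvd hd
        rw [abs_lt]; constructor <;> omega
      have hl0 : l.val ≠ 0 := by
        intro h; rw [h] at h0; simp at h0; omega
      have hk0 : k.val = 0 := by
        by_contra hk0
        have d1 : (2 : ℤ) ∣ 2 ^ l.val := dvd_pow_self _ hl0
        have d2 : (2 : ℤ) ∣ 2 ^ k.val := dvd_pow_self _ hk0
        have d3 : (2 : ℤ) ∣ 2 ^ i := dvd_pow_self _ (by omega)
        omega
      rw [hk0] at h0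
      have h3 : (2 : ℤ) ^ l.val = 2 ^ i := by linarith
      have h4 : l.val = i := pow_right_injective₀ (by norm_num : (0 : ℤ) < 2) (by norm_num) h3
      funext r
      rw [Subsingleton.elim r 0, hf, (ZMod.val_eq_zero k).mp hk0, ← h4]
      simp
    · rintro rfl
      simp [he, ZMod.val_cast_of_lt hin]
  rw [hset, sum_singleton] at hz
  simp [hB, ZMod.val_cast_of_lt hin] at hz
  exact hai hz


open Finset in
lemma small_two (E : Type*) [Field E] [Fintype E] [CharP E 3] (hE : Fintype.card E = 9)
    (t c c' : E) (ht : t ≠ 0) (hc : c ≠ 0)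
    (hP : ∀ x : E, x ≠ 0 → (t + c * x ^ 2 + c' * x ^ 6) ^ 2 = 1) : False := by
  have hz := coeff_zero E (Fin 3) ![t, c, c'] ![0, 2, 6] 2 (by
    intro x hx
    have := hP x hx
    simp only [Fin.sum_univ_three, Matrix.cons_val_zero, Matrix.cons_val_one, Matrix.cons_val,
      Fin.isValue, zpow_zero, mul_one]
    exact_mod_cast this) 2 (by rw [hE]; norm_num)
  rw [hE] at hz
  have hs : (univ.filter fun f : Fin 2 → Fin 3 =>
      (((9 : ℕ) : ℤ) - 1) ∣ (∑ r, (![0, 2, 6] : Fin 3 → ℤ) (f r)) - 2) = {![0, 1], ![1, 0]} := by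
    decide +kernel
  rw [hs, sum_pair (by decide)] at hz
  simp only [Fin.prod_univ_two, Matrix.cons_val_zero, Matrix.cons_val_one, Fin.isValue] at hz
  have h3 : (3 : E) = 0 := by exact_mod_cast CharP.cast_eq_zero E 3
  have : t * c = 0 := by linear_combination (t * c) * h3 - hz
  exact mul_ne_zero ht hc this

open Finset in
lemma small_three (E : Type*) [Field E] [Fintype E] [CharP E 3] (hE : Fintype.card E = 27)
    (w : ℕ) (hw : w = 2 ∨ w = 8)
    (t c c' c'' : E) (ht : t ≠ 0) (hc : c ≠ 0)
    (hP : ∀ x : E, x ≠ 0 → (t + c * x ^ w + c' * x ^ (3 * w) + c'' * x ^ (9 * w)) ^ 2 = 1) :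
    False := by
  have hz := coeff_zero E (Fin 4) ![t, c, c', c''] ![0, w, 3 * w, 9 * w] 2 (by
    intro x hx
    have := hP x hx
    simp only [Fin.sum_univ_four, Matrix.cons_val_zero, Matrix.cons_val_one, Matrix.cons_val,
      Fin.isValue, zpow_zero, mul_one]
    exact_mod_cast this) w (by rw [hE]; rcases hw with rfl | rfl <;> norm_num)
  rw [hE] at hz
  have hs : (univ.filter fun f : Fin 2 → Fin 4 =>
      (((27 : ℕ) : ℤ) - 1) ∣ (∑ r, (![0, (w : ℤ), 3 * w, 9 * w] : Fin 4 → ℤ) (f r)) - w)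
        = {![0, 1], ![1, 0]} := by
    rcases hw with rfl | rfl <;> decide +kernel
  rw [hs, sum_pair (by decide)] at hz
  simp only [Fin.prod_univ_two, Matrix.cons_val_zero, Matrix.cons_val_one, Fin.isValue] at hz
  have h3 : (3 : E) = 0 := by exact_mod_cast CharP.cast_eq_zero E 3
  have : t * c = 0 := by linear_combination (t * c) * h3 - hz
  exact mul_ne_zero ht hc this

open Finset in
lemma small_four (E : Type*) [Field E] [Fintype E] [CharP E 2] (hE : Fintype.card E = 64)
    (w : ℕ) (hw : w = 3 ∨ w = 15)
    (t c c' c'' : E) (ht : t ≠ 0) (hc : c ≠ 0)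
    (hP : ∀ x : E, x ≠ 0 → (t + c * x ^ w + c' * x ^ (4 * w) + c'' * x ^ (16 * w)) ^ 3 = 1) :
    False := by
  have hz := coeff_zero E (Fin 4) ![t, c, c', c''] ![0, w, 4 * w, 16 * w] 3 (by
    intro x hx
    have := hP x hx
    simp only [Fin.sum_univ_four, Matrix.cons_val_zero, Matrix.cons_val_one, Matrix.cons_val,
      Fin.isValue, zpow_zero, mul_one]
    exact_mod_cast this) w (by rw [hE]; rcases hw with rfl | rfl <;> norm_num)
  rw [hE] at hz
  have hs : (univ.filter fun f : Fin 3 → Fin 4 =>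
      (((64 : ℕ) : ℤ) - 1) ∣ (∑ r, (![0, (w : ℤ), 4 * w, 16 * w] : Fin 4 → ℤ) (f r)) - w)
        = {![0, 0, 1], ![0, 1, 0], ![1, 0, 0]} := by
    rcases hw with rfl | rfl <;> decide +kernel
  rw [hs, sum_insert (by decide), sum_pair (by decide)] at hz
  simp only [Fin.prod_univ_three, Matrix.cons_val_zero, Matrix.cons_val_one, Matrix.cons_val,
    Fin.isValue] at hz
  have h2 : (2 : E) = 0 := by exact_mod_cast CharP.cast_eq_zero E 2
  have : t * t * c = 0 := by linear_combination hz - (t * t * c) * h2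
  exact mul_ne_zero (mul_ne_zero ht ht) hc this

/-- the case `q = 3`, `n = 2` -/
lemma case_3_2 (E : Type*) [Field E] [Fintype E] [CharP E 3] (hE : Fintype.card E = 3 ^ 2)
    (a : ℕ → E)
    (h : ∀ x : E, x ≠ 0 →
      ∑ j ∈ Finset.range 2, ((∑ i ∈ Finset.range 2, a i * x ^ 3 ^ i) / x) ^ 3 ^ j ≠ 0)
    (hTr : ∑ j ∈ Finset.range 2, (a 0) ^ 3 ^ j ≠ 0) (h1 : a 1 ≠ 0) : False := by
  have : Fact (Nat.Prime 3) := ⟨Nat.prime_three⟩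
  refine small_two E (by rw [hE]; norm_num) (∑ j ∈ Finset.range 2, (a 0) ^ 3 ^ j) (a 1)
    ((a 1) ^ 3) hTr h1 fun x hx => ?_
  have := trace_pow 3 1 3 2 Nat.prime_three (by norm_num) E hE _ (h x hx)
  rw [← this]
  have hy : (∑ i ∈ Finset.range 2, a i * x ^ 3 ^ i) / x = a 0 + a 1 * x ^ 2 := by
    simp only [Finset.sum_range_succ, Finset.sum_range_zero]
    field_simp; ring
  rw [hy]
  simp only [Finset.sum_range_succ, Finset.sum_range_zero, pow_zero, pow_one, zero_add,
    add_pow_char]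
  congr 1; ring

/-- the case `q = 3`, `n = 3` -/
lemma case_3_3 (E : Type*) [Field E] [Fintype E] [CharP E 3] (hE : Fintype.card E = 3 ^ 3)
    (a : ℕ → E)
    (h : ∀ x : E, x ≠ 0 →
      ∑ j ∈ Finset.range 3, ((∑ i ∈ Finset.range 3, a i * x ^ 3 ^ i) / x) ^ 3 ^ j ≠ 0)
    (hTr : ∑ j ∈ Finset.range 3, (a 0) ^ 3 ^ j ≠ 0)
    (h12 : (a 1 ≠ 0 ∧ a 2 = 0) ∨ (a 1 = 0 ∧ a 2 ≠ 0)) : False := by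
  have : Fact (Nat.Prime 3) := ⟨Nat.prime_three⟩
  have key : ∀ w c, (w = 2 ∨ w = 8) → c ≠ 0 → (∀ x : E, x ≠ 0 →
      (∑ i ∈ Finset.range 3, a i * x ^ 3 ^ i) / x = a 0 + c * x ^ w) → False := by
    intro w c hw hc hy
    refine small_three E (by rw [hE]; norm_num) w hw (∑ j ∈ Finset.range 3, (a 0) ^ 3 ^ j) c
      (c ^ 3) (c ^ 9) hTr hc fun x hx => ?_
    have := trace_pow 3 1 3 3 Nat.prime_three (by norm_num) E hE _ (h x hx)
    rw [← this, hy x hx]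
    have e9 : (a 0 + c * x ^ w) ^ 3 ^ 2 = (a 0) ^ 3 ^ 2 + (c * x ^ w) ^ 3 ^ 2 :=
      add_pow_char_pow ..
    simp only [Finset.sum_range_succ, Finset.sum_range_zero, pow_zero, pow_one, zero_add,
      add_pow_char, e9]
    congr 1; ring
  rcases h12 with ⟨h1, h2⟩ | ⟨h1, h2⟩
  · refine key 2 (a 1) (Or.inl rfl) h1 fun x hx => ?_
    simp only [Finset.sum_range_succ, Finset.sum_range_zero, h2]
    field_simp; ring
  · refine key 8 (a 2) (Or.inr rfl) h2 fun x hx => ?_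
    simp only [Finset.sum_range_succ, Finset.sum_range_zero, h1]
    field_simp; ring

/-- the case `q = 4`, `n = 3` -/
lemma case_4_3 (E : Type*) [Field E] [Fintype E] [CharP E 2] (hE : Fintype.card E = 4 ^ 3)
    (a : ℕ → E)
    (h : ∀ x : E, x ≠ 0 →
      ∑ j ∈ Finset.range 3, ((∑ i ∈ Finset.range 3, a i * x ^ 4 ^ i) / x) ^ 4 ^ j ≠ 0)
    (hTr : ∑ j ∈ Finset.range 3, (a 0) ^ 4 ^ j ≠ 0)
    (h12 : (a 1 ≠ 0 ∧ a 2 = 0) ∨ (a 1 = 0 ∧ a 2 ≠ 0)) : False := by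
  have : Fact (Nat.Prime 2) := ⟨Nat.prime_two⟩
  have key : ∀ w c, (w = 3 ∨ w = 15) → c ≠ 0 → (∀ x : E, x ≠ 0 →
      (∑ i ∈ Finset.range 3, a i * x ^ 4 ^ i) / x = a 0 + c * x ^ w) → False := by
    intro w c hw hc hy
    refine small_four E (by rw [hE]; norm_num) w hw (∑ j ∈ Finset.range 3, (a 0) ^ 4 ^ j) c
      (c ^ 4) (c ^ 16) hTr hc fun x hx => ?_
    have := trace_pow 2 2 4 3 Nat.prime_two (by norm_num) E hE _ (h x hx)
    rw [← this, hy x hx]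
    have e4 : (a 0 + c * x ^ w) ^ 4 = (a 0) ^ 4 + (c * x ^ w) ^ 4 := by
      have := add_pow_char_pow (p := 2) (n := 2) (a 0) (c * x ^ w)
      norm_num only at this; exact this
    have e16 : (a 0 + c * x ^ w) ^ 4 ^ 2 = (a 0) ^ 4 ^ 2 + (c * x ^ w) ^ 4 ^ 2 := by
      have := add_pow_char_pow (p := 2) (n := 4) (a 0) (c * x ^ w)
      norm_num only at this ⊢; exact this
    simp only [Finset.sum_range_succ, Finset.sum_range_zero, pow_zero, pow_one, zero_add, e4, e16]
    congr 1; ring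
  rcases h12 with ⟨h1, h2⟩ | ⟨h1, h2⟩
  · refine key 3 (a 1) (Or.inl rfl) h1 fun x hx => ?_
    simp only [Finset.sum_range_succ, Finset.sum_range_zero, h2]
    field_simp; ring
  · refine key 15 (a 2) (Or.inr rfl) h2 fun x hx => ?_
    simp only [Finset.sum_range_succ, Finset.sum_range_zero, h1]
    field_simp; ring

lemma lead_spec (p N j : ℕ) : ∃ u : ℕ, leadFn p N j % N = j * p ^ u % N :=
  Nat.sInf_mem (s := {k : ℕ | ∃ u : ℕ, k % N = j * p ^ u % N}) ⟨j, 0, by simp⟩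

lemma lead_spec_zmod (p N j : ℕ) : ∃ u : ℕ, ((leadFn p N (j % N) : ℕ) : ZMod N)
    = (j : ZMod N) * (p : ZMod N) ^ u := by
  obtain ⟨u, hu⟩ := lead_spec p N (j % N)
  refine ⟨u, ?_⟩
  have := (ZMod.natCast_eq_natCast_iff' _ _ N).mpr hu
  rw [this]; push_cast; simp

lemma p_pow_zmod (p m q n : ℕ) (hp : p.Prime) (hq : q = p ^ m) :
    (p : ZMod (q ^ n - 1)) ^ (m * n) = 1 := by
  have h1 : ((q ^ n - 1 : ℕ) : ZMod (q ^ n - 1)) = 0 := ZMod.natCast_self _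
  have hq0 : 1 ≤ q ^ n := Nat.one_le_pow _ _ (by rw [hq]; exact pow_pos hp.pos m)
  rw [Nat.cast_sub hq0, sub_eq_zero] at h1
  rw [pow_mul, ← Nat.cast_pow, ← hq, ← Nat.cast_pow]; simpa using h1

lemma lead_pos (p m q n i j : ℕ) (hp : p.Prime) (hm : 1 ≤ m) (hq : q = p ^ m) (hi : 1 ≤ i)
    (hin : i < n) (hj : Nat.gcd j (q ^ n - 1) = 1) :
    1 ≤ leadFn p (q ^ n - 1) (j * (q ^ i - 1) % (q ^ n - 1)) := by
  by_contra h0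
  obtain ⟨u, hu⟩ := lead_spec_zmod p (q ^ n - 1) (j * (q ^ i - 1))
  have h00 : leadFn p (q ^ n - 1) (j * (q ^ i - 1) % (q ^ n - 1)) = 0 := by omega
  rw [h00] at hu
  have hpu : IsUnit (p : ZMod (q ^ n - 1)) :=
    IsUnit.of_pow_eq_one (p_pow_zmod p m q n hp hq) (Nat.mul_ne_zero (by omega) (by omega))
  have hju : IsUnit (j : ZMod (q ^ n - 1)) := (ZMod.isUnit_iff_coprime j _).mpr hj
  push_cast at hu
  have h1 := ((hpu.pow u).mul_left_eq_zero).mp hu.symm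
  have h2 := (hju.mul_right_eq_zero).mp h1
  have h3 := (ZMod.natCast_eq_zero_iff _ _).mp h2
  have hq2 : 2 ≤ q := by rw [hq]; exact le_trans hp.two_le (Nat.le_self_pow (by omega) p)
  have h4 : q ^ i < q ^ n := Nat.pow_lt_pow_right (by omega) hin
  have h5 : 2 ≤ q ^ i := le_trans hq2 (Nat.le_self_pow (by omega) q)
  have := Nat.le_of_dvd (by omega) h3
  omega

lemma lead_pair (p m q n i j : ℕ) (hp : p.Prime) (hm : 1 ≤ m) (hq : q = p ^ m) (hi : 1 ≤ i)
    (hin : i < n) (hj : Nat.gcd j (q ^ n - 1) = 1) (B : ℕ)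
    (hB : leadFn p (q ^ n - 1) (j * (q ^ i - 1) % (q ^ n - 1)) ≤ B)
    (hB' : leadFn p (q ^ n - 1) (j * (q ^ (n - i) - 1) % (q ^ n - 1)) ≤ B) :
    ∃ w, p ^ w * p ^ w ≤ q ^ n ∧ q ^ n - 1 ≤ B * (1 + p ^ w) := by
  obtain ⟨u, hu⟩ := lead_spec_zmod p (q ^ n - 1) (j * (q ^ i - 1))
  obtain ⟨u', hu'⟩ := lead_spec_zmod p (q ^ n - 1) (j * (q ^ (n - i) - 1))
  have he := lead_pos p m q n i j hp hm hq hi hin hj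
  have hp1 := p_pow_zmod p m q n hp hq
  have hq1 : 1 ≤ q := by rw [hq]; exact pow_pos hp.pos m
  have hQ : q ^ n = p ^ (m * n) := by rw [hq, ← pow_mul]
  generalize leadFn p (q ^ n - 1) (j * (q ^ i - 1) % (q ^ n - 1)) = e at *
  generalize leadFn p (q ^ n - 1) (j * (q ^ (n - i) - 1) % (q ^ n - 1)) = e' at *
  have hmn : 1 ≤ m * n := Nat.mul_pos (by omega) (by omega)
  obtain ⟨M, hM⟩ : ∃ M, m * n = M + 1 := ⟨m * n - 1, by omega⟩
  have hqz : (q : ZMod (q ^ n - 1)) = (p : ZMod (q ^ n - 1)) ^ m := by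
    have := congrArg (Nat.cast : ℕ → ZMod (q ^ n - 1)) hq
    rw [Nat.cast_pow] at this
    exact this
  push_cast [Nat.cast_sub (Nat.one_le_pow i q hq1), Nat.cast_sub (Nat.one_le_pow (n - i) q hq1)]
    at hu hu'
  have hqn : (q : ZMod (q ^ n - 1)) ^ i * (q : ZMod (q ^ n - 1)) ^ (n - i) = 1 := by
    rw [← pow_add, hqz, ← pow_mul, show i + (n - i) = n by omega, hp1]
  have key : ∃ w, w < m * n ∧ (e : ZMod (q ^ n - 1)) + e' * (p : ZMod (q ^ n - 1)) ^ w = 0 := by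
    refine ⟨(m * i + u + u' * M) % (m * n), Nat.mod_lt _ (by omega), ?_⟩
    rw [← pow_eq_pow_mod _ hp1, hu, hu']
    have h1 : (p : ZMod (q ^ n - 1)) ^ u' * (p : ZMod (q ^ n - 1)) ^ (u' * M) = 1 := by
      rw [← pow_add, show u' + u' * M = (m * n) * u' by rw [hM]; ring, pow_mul, hp1, one_pow]
    rw [pow_add, pow_add, pow_mul, ← hqz]
    linear_combination (j * (q : ZMod (q ^ n - 1)) ^ i * ((q : ZMod (q ^ n - 1)) ^ (n - i) - 1) *
      (p : ZMod (q ^ n - 1)) ^ u) * h1 + (j * (p : ZMod (q ^ n - 1)) ^ u) * hqn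
  obtain ⟨w, hw, hz⟩ := key
  have fin : ∀ w x y, 2 * w ≤ m * n → 1 ≤ x + y * p ^ w → x ≤ B → y ≤ B →
      (x : ZMod (q ^ n - 1)) + y * (p : ZMod (q ^ n - 1)) ^ w = 0 →
      ∃ w, p ^ w * p ^ w ≤ q ^ n ∧ q ^ n - 1 ≤ B * (1 + p ^ w) := by
    intro w x y hw hxy hx hy hz
    refine ⟨w, ?_, ?_⟩
    · rw [← pow_add, hQ]; exact Nat.pow_le_pow_right hp.pos (by omega)
    · have : ((x + y * p ^ w : ℕ) : ZMod (q ^ n - 1)) = 0 := by push_cast; exact hz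
      have := Nat.le_of_dvd hxy ((ZMod.natCast_eq_zero_iff _ _).mp this)
      calc _ ≤ _ := this
        _ ≤ B + B * p ^ w := by gcongr
        _ = _ := by ring
  by_cases h2 : 2 * w ≤ m * n
  · exact fin w e e' h2 (by omega) hB hB' hz
  · refine fin (m * n - w) e' e (by omega) ?_ hB' hB ?_
    · have : 1 ≤ e * p ^ (m * n - w) := Nat.mul_pos he (pow_pos hp.pos _)
      omega
    · have h1 : (p : ZMod (q ^ n - 1)) ^ w * (p : ZMod (q ^ n - 1)) ^ (m * n - w) = 1 := by
        rw [← pow_add, show w + (m * n - w) = m * n by omega, hp1]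
      linear_combination (p : ZMod (q ^ n - 1)) ^ (m * n - w) * hz - e' * h1

/-- opposite coefficients -/
lemma case_A (p m q n i j : ℕ) (hp : p.Prime) (hm : 1 ≤ m) (hq : q = p ^ m) (hi : 1 ≤ i)
    (hin : i < n) (hj : Nat.gcd j (q ^ n - 1) = 1) (hqn : 4 ≤ q ∨ (q = 3 ∧ 3 ≤ n))
    (hB : leadFn p (q ^ n - 1) (j * (q ^ i - 1) % (q ^ n - 1)) ≤ ⌈2 * (q : ℝ) ^ n /
            (((q : ℝ) - 1) * (⌊2 * Real.sqrt ((q : ℝ) ^ n)⌋₊ : ℝ))⌉₊)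
    (hB' : leadFn p (q ^ n - 1) (j * (q ^ (n - i) - 1) % (q ^ n - 1)) ≤ ⌈2 * (q : ℝ) ^ n /
            (((q : ℝ) - 1) * (⌊2 * Real.sqrt ((q : ℝ) ^ n)⌋₊ : ℝ))⌉₊) : False := by
  obtain ⟨w, hw1, hw2⟩ := lead_pair p m q n i j hp hm hq hi hin hj _ hB hB'
  clear hB hB'
  set s := Real.sqrt ((q : ℝ) ^ n) with hs
  have hss : s * s = (q : ℝ) ^ n := Real.mul_self_sqrt (by positivity)
  have hs0 : 0 ≤ s := Real.sqrt_nonneg _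
  have hq3 : (3 : ℝ) ≤ q := by
    have : 3 ≤ q := by omega
    exact_mod_cast this
  have hs5 : (4 ≤ (q : ℝ) ∧ 4 ≤ s) ∨ 5 ≤ s := by
    rcases hqn with h4 | ⟨h3, hn⟩
    · left
      have h4' : (4 : ℝ) ≤ q := by exact_mod_cast h4
      refine ⟨h4', ?_⟩
      have : (16 : ℝ) ≤ (q : ℝ) ^ n := by
        calc (16 : ℝ) = 4 ^ 2 := by norm_num
          _ ≤ (q : ℝ) ^ 2 := by gcongr
          _ ≤ (q : ℝ) ^ n := pow_le_pow_right₀ (by linarith) (by omega)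
      nlinarith
    · right
      have : (27 : ℝ) ≤ (q : ℝ) ^ n := by
        calc (27 : ℝ) = 3 ^ 3 := by norm_num
          _ ≤ (q : ℝ) ^ 3 := by gcongr
          _ ≤ (q : ℝ) ^ n := pow_le_pow_right₀ (by linarith) (by omega)
      nlinarith
  have hs4 : 4 ≤ s := by rcases hs5 with h | h <;> linarith [h]
  have hfl := Nat.lt_floor_add_one (2 * s)
  set fl : ℝ := (⌊2 * s⌋₊ : ℝ) with hfldef
  have hflpos : 0 < fl := by linarith
  have hden : 0 < ((q : ℝ) - 1) * fl := mul_pos (by linarith) hflpos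
  have hx0 : 0 ≤ 2 * (q : ℝ) ^ n / (((q : ℝ) - 1) * fl) := by positivity
  have hc := Nat.ceil_lt_add_one hx0
  set C := ⌈2 * (q : ℝ) ^ n / (((q : ℝ) - 1) * fl)⌉₊ with hC
  have hpw : ((p : ℝ) ^ w) ≤ s := by
    have : ((p : ℝ) ^ w) * (p : ℝ) ^ w ≤ s * s := by rw [hss]; exact_mod_cast hw1
    exact (mul_self_le_mul_self_iff (by positivity) hs0).mpr this
  have h1 : (q : ℝ) ^ n - 1 ≤ C * (1 + (p : ℝ) ^ w) := by
    have : q ^ n ≤ C * (1 + p ^ w) + 1 := by omega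
    have : (q : ℝ) ^ n ≤ C * (1 + (p : ℝ) ^ w) + 1 := by exact_mod_cast this
    linarith
  have h2 : s - 1 ≤ C := by
    have : (C : ℝ) * (1 + (p : ℝ) ^ w) ≤ C * (1 + s) := by gcongr
    nlinarith
  have h3 : (s - 2) < 2 * (q : ℝ) ^ n / (((q : ℝ) - 1) * fl) := by linarith
  rw [lt_div_iff₀ hden, ← hss] at h3
  have h4 : (s - 2) * (((q : ℝ) - 1) * (2 * s - 1)) ≤ (s - 2) * (((q : ℝ) - 1) * fl) := by
    apply mul_le_mul_of_nonneg_left _ (by linarith)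
    apply mul_le_mul_of_nonneg_left _ (by linarith)
    linarith
  have h5 : 0 ≤ (s - 2) * (2 * s - 1) := mul_nonneg (by linarith) (by linarith)
  rcases hs5 with ⟨h6, h7⟩ | h6
  · nlinarith [mul_le_mul_of_nonneg_right (show (3 : ℝ) ≤ q - 1 by linarith) h5]
  · nlinarith [mul_le_mul_of_nonneg_right (show (2 : ℝ) ≤ q - 1 by linarith) h5]

/-- degree three, `q ≥ 5` -/
lemma case_C (p m q i j : ℕ) (hp : p.Prime) (hm : 1 ≤ m) (hq : q = p ^ m) (hi : 1 ≤ i)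
    (hin : i < 3) (hj : Nat.gcd j (q ^ 3 - 1) = 1) (hq5 : 5 ≤ q) :
    1 + ⌈2 * (q : ℝ) ^ 3 / (((q : ℝ) - 1) * (⌊2 * Real.sqrt ((q : ℝ) ^ 3)⌋₊ : ℝ))⌉₊
      ≤ leadFn p (q ^ 3 - 1) (j * (q ^ i - 1) % (q ^ 3 - 1)) := by
  have he := lead_pos p m q 3 i j hp hm hq hi hin hj
  have hdvd : (q - 1) ∣ leadFn p (q ^ 3 - 1) (j * (q ^ i - 1) % (q ^ 3 - 1)) := by
    have d1 : ∀ k, (q - 1) ∣ q ^ k - 1 := fun k => by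
      simpa using Nat.sub_dvd_pow_sub_pow q 1 k
    obtain ⟨u, hu⟩ := lead_spec p (q ^ 3 - 1) (j * (q ^ i - 1) % (q ^ 3 - 1))
    rw [← Nat.dvd_mod_iff (d1 3), hu, Nat.dvd_mod_iff (d1 3)]
    apply Dvd.dvd.mul_right
    rw [Nat.dvd_mod_iff (d1 3)]
    exact (d1 i).mul_left _
  refine le_trans ?_ (Nat.le_of_dvd he hdvd)
  have hq5' : (5 : ℝ) ≤ q := by exact_mod_cast hq5
  set s := Real.sqrt ((q : ℝ) ^ 3) with hs
  have hss : s * s = (q : ℝ) ^ 3 := Real.mul_self_sqrt (by positivity)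
  have hs0 : 0 ≤ s := Real.sqrt_nonneg _
  have hfl := Nat.lt_floor_add_one (2 * s)
  set fl : ℝ := (⌊2 * s⌋₊ : ℝ) with hfldef
  have hs2 : 2.2 * (q : ℝ) ≤ s := by
    apply Real.le_sqrt_of_sq_le
    nlinarith [mul_nonneg (sq_nonneg (q : ℝ)) (show (0 : ℝ) ≤ q - 5 by linarith)]
  have hflq : 4.2 * (q : ℝ) ≤ fl := by linarith
  have hden : 0 < ((q : ℝ) - 1) * fl := mul_pos (by linarith) (by linarith)
  have : ⌈2 * (q : ℝ) ^ 3 / (((q : ℝ) - 1) * fl)⌉₊ ≤ q - 2 := by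
    rw [Nat.ceil_le, Nat.cast_sub (by omega), div_le_iff₀ hden]
    push_cast
    have h1 : (12 / 25) * (q : ℝ) ^ 2 ≤ ((q : ℝ) - 2) * (q - 1) := by nlinarith
    calc 2 * (q : ℝ) ^ 3 ≤ ((12 / 25) * (q : ℝ) ^ 2) * (4.2 * q) := by
            nlinarith [pow_pos (show (0 : ℝ) < q by linarith) 3]
      _ ≤ (((q : ℝ) - 2) * (q - 1)) * fl := by
            apply mul_le_mul h1 hflq (by positivity)
            exact mul_nonneg (by linarith) (by linarith)
      _ = _ := by ring
  omega

theorem stmt_16 (p m q n : ℕ) (hp : p.Prime) (hm : 1 ≤ m) (hq : q = p ^ m) (hn : 1 ≤ n)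
    (E : Type*) [Field E] [Fintype E] (hE : Fintype.card E = q ^ n)
    (a : ℕ → E) (ha : ∃ i : ℕ, 1 ≤ i ∧ i ≤ n - 1 ∧ a i ≠ 0)
    (h : ∀ x : E, x ≠ 0 →
      ∑ j ∈ Finset.range n, ((∑ i ∈ Finset.range n, a i * x ^ q ^ i) / x) ^ q ^ j ≠ 0)
    (hTr : ∑ j ∈ Finset.range n, (a 0) ^ q ^ j ≠ 0) :
    ∀ j : ℕ, 1 ≤ j → j ≤ q ^ n - 2 → Nat.gcd j (q ^ n - 1) = 1 →
      ∃ i : ℕ, 1 ≤ i ∧ i ≤ n - 1 ∧ a i ≠ 0 ∧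
        1 + ⌈2 * (q : ℝ) ^ n /
            (((q : ℝ) - 1) * (⌊2 * Real.sqrt ((q : ℝ) ^ n)⌋₊ : ℝ))⌉₊
          ≤ leadFn p (q ^ n - 1) (j * (q ^ i - 1) % (q ^ n - 1)) := by
  intro j _ _ hj
  by_contra hcon
  push Not at hcon
  have hn0 : NeZero n := ⟨by omega⟩
  have hpf : Fact p.Prime := ⟨hp⟩
  have hchar : CharP E p := charP_of_card_eq_prime_pow (f := m * n) (by
    rw [hE, hq, ← pow_mul])
  have hq2 : 2 ≤ q := by rw [hq]; exact le_trans hp.two_le (Nat.le_self_pow (by omega) p)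
  obtain ⟨i₀, hi1, hi2, hai⟩ := ha
  have hlt : i₀ < n := by omega
  -- the case `q = 2`
  by_cases hq2' : q = 2
  · have hp2 : p = 2 := by
      have : p ≤ q := by rw [hq]; exact Nat.le_self_pow (by omega) p
      have := hp.two_le
      omega
    subst hq2' hp2
    exact case_two n E hE a h i₀ hi1 hlt hai
  have hq3 : 3 ≤ q := by omega
  have hp3 : q = 3 → p = 3 := by
    intro h3
    have : p ∣ 3 := by rw [← h3, hq]; exact dvd_pow_self _ (by omega)
    exact (Nat.prime_dvd_prime_iff_eq hp Nat.prime_three).mp this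
  have hp4 : q = 4 → p = 2 := by
    intro h4
    have : p ∣ 2 ^ 2 := by
      have : p ∣ q := by rw [hq]; exact dvd_pow_self _ (by omega)
      rw [h4] at this; exact this
    exact (Nat.prime_dvd_prime_iff_eq hp Nat.prime_two).mp (hp.dvd_of_dvd_pow this)
  -- opposite nonzero coefficients
  by_cases hop : ∃ i, 1 ≤ i ∧ i < n ∧ a i ≠ 0 ∧ a (n - i) ≠ 0
  · obtain ⟨i, h1, h2, h3, h4⟩ := hop
    by_cases hqn : 4 ≤ q ∨ (q = 3 ∧ 3 ≤ n)
    · exact case_A p m q n i j hp hm hq h1 h2 hj hqn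
        (by have := hcon i h1 (by omega) h3; omega)
        (by have := hcon (n - i) (by omega) (by omega) h4; omega)
    · have e3 : q = 3 := by omega
      have en : n = 2 := by omega
      have ei : i = 1 := by omega
      have ep := hp3 e3
      subst e3 en ei ep
      exact case_3_2 E hE a h hTr h3
  push Not at hop
  -- translate to `ZMod n`
  have hop' : ∀ i : ZMod n, i ≠ 0 → a i.val ≠ 0 → a (-i).val = 0 := by
    intro i hi h0
    have : NeZero i := ⟨hi⟩
    rw [ZMod.val_neg_of_ne_zero]
    have hv : i.val ≠ 0 := fun e => hi ((ZMod.val_eq_zero i).mp e)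
    exact hop i.val (by omega) (ZMod.val_lt i) h0
  have htwo : ∀ i : ZMod n, i ≠ 0 → a i.val ≠ 0 → i + i ≠ 0 := by
    intro i hi h0 e
    have h1 := hop' i hi h0
    rw [show -i = i by linear_combination -e] at h1
    exact h0 h1
  -- some index not killed by three
  by_cases hthree : ∃ i : ZMod n, i ≠ 0 ∧ a i.val ≠ 0 ∧ 3 * i ≠ 0
  · obtain ⟨i, hi, h0, h3⟩ := hthree
    refine padic_main p m q n hp hq hq3 E hE a h i (2 * i) hi ?_ ?_ ?_ h0 (hop' i hi h0) ?_
    · rw [two_mul]; exact htwo i hi h0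
    · intro e; apply hi; linear_combination e
    · intro e; apply h3; linear_combination e
    · rw [show i - 2 * i = -i by ring]; exact hop' i hi h0
  push Not at hthree
  have hi0 : (i₀ : ZMod n) ≠ 0 := by
    intro e
    have := ZMod.val_cast_of_lt hlt
    rw [e, ZMod.val_zero] at this; omega
  have hai' : a (i₀ : ZMod n).val ≠ 0 := by rwa [ZMod.val_cast_of_lt hlt]
  have h3i := hthree _ hi0 hai'
  have hn2 : 2 ≤ n := by omega
  by_cases hn3 : (3 : ZMod n) ≠ 0
  · have h10 : (1 : ZMod n) ≠ 0 := by
      intro e; apply hn3; linear_combination 3 * e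
    refine padic_main p m q n hp hq hq3 E hE a h (i₀ : ZMod n) 1 hi0 h10 ?_ ?_ hai'
      (hop' _ hi0 hai') ?_
    · intro e; apply hn3; rw [← e] at h3i; simpa using h3i
    · intro e; apply hn3; linear_combination 3 * e - h3i
    · by_contra hne
      have hne0 : (i₀ : ZMod n) - 1 ≠ 0 := by
        intro e; apply hn3; linear_combination h3i - 3 * e
      have := hthree _ hne0 hne
      apply hn3; linear_combination h3i - this
  · have hdv : n ∣ 3 := by
      rw [not_not] at hn3
      exact (ZMod.natCast_eq_zero_iff 3 n).mp (by exact_mod_cast hn3)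
    have en : n = 3 := by
      rcases (Nat.dvd_prime Nat.prime_three).mp hdv with h | h <;> omega
    subst en
    have h12 : (a 1 ≠ 0 ∧ a 2 = 0) ∨ (a 1 = 0 ∧ a 2 ≠ 0) := by
      have hh1 := hop 1 (by omega) (by omega)
      have : i₀ = 1 ∨ i₀ = 2 := by omega
      rcases this with rfl | rfl
      · exact Or.inl ⟨hai, hh1 hai⟩
      · refine Or.inr ⟨?_, hai⟩
        by_contra h1
        exact hai (hh1 h1)
    by_cases h5 : 5 ≤ q
    · have h1 := case_C p m q i₀ j hp hm hq hi1 hlt hj h5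
      have h2 := hcon i₀ hi1 hi2 hai
      omega
    · have : q = 3 ∨ q = 4 := by omega
      rcases this with e | e
      · have ep := hp3 e
        subst e ep
        exact case_3_3 E hE a h hTr h12
      · have ep := hp4 e
        subst e ep
        exact case_4_3 E hE a h hTr h12
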